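/- Let α > 0 and let the family (μ^(k)) be in the mean Nevai class M^(C,α)(Σ_{la,lb}) for the Cesàro summation weights σ_{n,k}^(C,α) = α Γ(n−k+α) Γ(n+1) / ( Γ(n−k+1) Γ(n+α+1) ), with limits Σ_{la,lb} = 0 for la ≥ 1 and Σ_{0,lb} = Γ(α/2+1) Γ(lb/2+1) / ( 2^{lb} Γ((α+lb)/2 + 1) ) for all lb ∈ ℕ. Then for every bounded continuous function f : ℝ → ℝ, lim_{n→∞} Σ_{k=0}^n σ_{n,k}^(C,α) ∫_ℝ f(x) (p_k^(n−k)(x))² dμ^(n−k)(x) = (1/m^(α/2)) ∫_{−1}^1 f(x) (1−x²)^{(α−1)/2} dx, where m^(α/2) = ∫_{−1}^1 (1−x²)^{(α−1)/2} dx; that is, the equilibrium measure of this mean Nevai class is the normalized ultraspherical measure with parameter α/2. -/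

import Mathlib

open Filter MeasureTheory

/-- The weighted averages of `|u (n - k) k|` with weights `σ n k` tend to `0`. -/
def MeanNull (σ : ℕ → ℕ → ℝ) (u : ℕ → ℕ → ℝ) : Prop :=
  Tendsto (fun n => ∑ k ∈ Finset.range (n + 1), σ n k * |u (n - k) k|) atTop (nhds 0)

namespace MeanNull

variable {σ u v w : ℕ → ℕ → ℝ}

theorem of_le (hσ : ∀ n k, k ≤ n → 0 ≤ σ n k) (hv : MeanNull σ v) (hw : MeanNull σ w)
    (C D : ℝ) (h : ∀ N k, |u N k| ≤ C * |v N k| + D * |w N k|) : MeanNull σ u := by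
  have hlim := (hv.const_mul C).add (hw.const_mul D)
  simp only [mul_zero, add_zero] at hlim
  refine squeeze_zero (fun n => Finset.sum_nonneg fun k hk => ?_) (fun n => ?_) hlim
  · exact mul_nonneg (hσ n k (Nat.lt_succ_iff.mp (Finset.mem_range.mp hk))) (abs_nonneg _)
  · rw [Finset.mul_sum, Finset.mul_sum, ← Finset.sum_add_distrib]
    refine Finset.sum_le_sum fun k hk => ?_
    have := mul_le_mul_of_nonneg_left (h (n - k) k)
      (hσ n k (Nat.lt_succ_iff.mp (Finset.mem_range.mp hk)))
    linarith

theorem zero : MeanNull σ (fun _ _ => 0) := by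
  simp [MeanNull]

theorem add (hσ : ∀ n k, k ≤ n → 0 ≤ σ n k) (hu : MeanNull σ u) (hv : MeanNull σ v) :
    MeanNull σ (fun N k => u N k + v N k) :=
  of_le hσ hu hv 1 1 fun N k => by simpa using abs_add_le _ _

theorem mono (hσ : ∀ n k, k ≤ n → 0 ≤ σ n k) (hv : MeanNull σ v)
    (h : ∀ N k, |u N k| ≤ |v N k|) : MeanNull σ u :=
  of_le hσ hv hv 1 0 fun N k => by simpa using h N k

theorem mul_bounded (hσ : ∀ n k, k ≤ n → 0 ≤ σ n k) (hu : MeanNull σ u) {C : ℝ}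
    (hv : ∀ N k, |v N k| ≤ C) : MeanNull σ (fun N k => u N k * v N k) :=
  of_le hσ hu hu C 0 fun N k => by
    rw [abs_mul]
    nlinarith [mul_le_mul_of_nonneg_left (hv N k) (abs_nonneg (u N k))]

theorem mul_sub_mul (hσ : ∀ n k, k ≤ n → 0 ≤ σ n k) {u' v' : ℕ → ℕ → ℝ}
    (hu : MeanNull σ (fun N k => u N k - u' N k)) (hv : MeanNull σ (fun N k => v N k - v' N k))
    {C D : ℝ} (hvC : ∀ N k, |v N k| ≤ C) (huD : ∀ N k, |u' N k| ≤ D) :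
    MeanNull σ (fun N k => u N k * v N k - u' N k * v' N k) := by
  have h := add hσ (mul_bounded hσ hu hvC) (mul_bounded hσ hv huD)
  have e : (fun N k => u N k * v N k - u' N k * v' N k) =
      fun N k => (u N k - u' N k) * v N k + (v N k - v' N k) * u' N k := by
    funext N k; ring
  rwa [e]

theorem tendsto (hσ : ∀ n k, k ≤ n → 0 ≤ σ n k)
    (h : MeanNull σ (fun N k => u N k - v N k)) {c : ℝ}
    (hv : Tendsto (fun n => ∑ k ∈ Finset.range (n + 1), σ n k * v (n - k) k) atTop (nhds c)) :
    Tendsto (fun n => ∑ k ∈ Finset.range (n + 1), σ n k * u (n - k) k) atTop (nhds c) := by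
  have h0 : Tendsto (fun n => ∑ k ∈ Finset.range (n + 1), σ n k * (u (n - k) k - v (n - k) k))
      atTop (nhds 0) := by
    refine squeeze_zero_norm (fun n => ?_) h
    refine (norm_sum_le _ _).trans (Finset.sum_le_sum fun k hk => ?_)
    rw [Real.norm_eq_abs, abs_mul,
      abs_of_nonneg (hσ n k (Nat.lt_succ_iff.mp (Finset.mem_range.mp hk)))]
  have := h0.add hv
  simp only [zero_add, ← Finset.sum_add_distrib] at this
  refine this.congr fun n => Finset.sum_congr rfl fun k _ => by ring

theorem of_sq (hσ : ∀ n k, k ≤ n → 0 ≤ σ n k)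
    (hσ1 : ∀ n, ∑ k ∈ Finset.range (n + 1), σ n k = 1)
    (h : Tendsto (fun n => ∑ k ∈ Finset.range (n + 1), σ n k * u (n - k) k ^ 2) atTop (nhds 0)) :
    MeanNull σ u := by
  have hs := h.sqrt
  rw [Real.sqrt_zero] at hs
  refine squeeze_zero (fun n => Finset.sum_nonneg fun k hk => ?_) (fun n => ?_) hs
  · exact mul_nonneg (hσ n k (Nat.lt_succ_iff.mp (Finset.mem_range.mp hk))) (abs_nonneg _)
  · refine Real.le_sqrt_of_sq_le ?_
    have := (convexOn_pow 2 (𝕜 := ℝ)).map_sum_le (t := Finset.range (n + 1)) (w := σ n)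
      (p := fun k => |u (n - k) k|)
      (fun k hk => hσ n k (Nat.lt_succ_iff.mp (Finset.mem_range.mp hk))) (hσ1 n)
      (fun k _ => Set.mem_Ici.mpr (abs_nonneg _))
    simpa [sq_abs] using this

theorem comp_pred (hσ : ∀ n k, k ≤ n → 0 ≤ σ n k) (hσ0 : Tendsto (fun n => σ n 0) atTop (nhds 0))
    (hstep : ∀ n k, k ≤ n → σ (n + 1) (k + 1) ≤ σ n k) (hu : MeanNull σ u) {C : ℝ}
    (huC : ∀ N k, |u N k| ≤ C) : MeanNull σ (fun N k => u N (k - 1)) := by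
  rw [MeanNull, ← tendsto_add_atTop_iff_nat 1]
  have hlim := Tendsto.add hu ((hσ0.comp (tendsto_add_atTop_nat 1)).mul_const C)
  simp only [zero_mul, add_zero] at hlim
  refine squeeze_zero (fun n => Finset.sum_nonneg fun k hk => ?_) (fun n => ?_) hlim
  · exact mul_nonneg (hσ _ k (Nat.lt_succ_iff.mp (Finset.mem_range.mp hk))) (abs_nonneg _)
  · rw [Finset.sum_range_succ']
    refine add_le_add (Finset.sum_le_sum fun k hk => ?_) ?_
    · simp only [Nat.add_sub_add_right, Nat.add_sub_cancel]
      exact mul_le_mul_of_nonneg_right (hstep n k (Nat.lt_succ_iff.mp (Finset.mem_range.mp hk)))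
        (abs_nonneg _)
    · exact mul_le_mul_of_nonneg_left (huC _ _) (hσ _ _ (Nat.zero_le _))

theorem comp_sub (hσ : ∀ n k, k ≤ n → 0 ≤ σ n k) (hσ0 : Tendsto (fun n => σ n 0) atTop (nhds 0))
    (hstep : ∀ n k, k ≤ n → σ (n + 1) (k + 1) ≤ σ n k) (hu : MeanNull σ u) {C : ℝ}
    (huC : ∀ N k, |u N k| ≤ C) (l : ℕ) : MeanNull σ (fun N k => u N (k - l)) := by
  induction l with
  | zero => simpa using hu
  | succ l ih =>
    have := comp_pred hσ hσ0 hstep ih (fun N k => huC N (k - l))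
    simpa [Nat.sub_sub, Nat.add_comm] using this

theorem shift_int (hσ : ∀ n k, k ≤ n → 0 ≤ σ n k)
    (hσ0 : Tendsto (fun n => σ n 0) atTop (nhds 0))
    (hstep : ∀ n k, k ≤ n → σ (n + 1) (k + 1) ≤ σ n k) {c : ℕ → ℕ → ℝ} {C : ℝ}
    (hc : ∀ N k, |c N k| ≤ C)
    (h : ∀ l : ℕ, 1 ≤ l → MeanNull σ (fun N k => c N (k + l) - c N k)) (i : ℤ) :
    MeanNull σ (fun N k => c N ((k : ℤ) + i).toNat - c N k) := by
  obtain ⟨l, rfl | rfl⟩ := i.eq_nat_or_neg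
  · have e : ∀ k : ℕ, ((k : ℤ) + (l : ℤ)).toNat = k + l := fun k => by omega
    simp only [e]
    rcases Nat.eq_zero_or_pos l with rfl | hl
    · simpa using zero
    · exact h l hl
  · have e : ∀ k : ℕ, ((k : ℤ) + -(l : ℤ)).toNat = k - l := fun k => by omega
    simp only [e]
    have h2C : ∀ N j k, |c N j - c N k| ≤ C + C := fun N j k =>
      (abs_sub _ _).trans (add_le_add (hc N j) (hc N k))
    have h1 : MeanNull σ (fun N k => c N (k - 1) - c N k) := by
      refine mono hσ (comp_pred hσ hσ0 hstep (h 1 le_rfl) (fun N k => h2C N _ _)) fun N k => ?_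
      rcases k with _ | k
      · simp
      · simp [abs_sub_comm]
    induction l with
    | zero => simpa using zero
    | succ l ih =>
      have := add hσ (comp_sub hσ hσ0 hstep h1 (fun N k => h2C N _ _) l) (ih fun k => by omega)
      simpa [Nat.sub_sub] using this

end MeanNull

theorem cesaro_weight_step {α : ℝ} (hα : 0 < α) {σ : ℕ → ℕ → ℝ}
    (hσ : ∀ n k : ℕ, k ≤ n → σ n k =
      α * Real.Gamma ((n:ℝ)-(k:ℝ)+α) * Real.Gamma ((n:ℝ)+1) /
        (Real.Gamma ((n:ℝ)-(k:ℝ)+1) * Real.Gamma ((n:ℝ)+α+1)))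
    (n k : ℕ) (hk : k ≤ n) : σ (n + 1) (k + 1) ≤ σ n k := by
  have hk' : (k : ℝ) ≤ n := by exact_mod_cast hk
  have hn : (0 : ℝ) ≤ n := n.cast_nonneg
  rw [hσ _ _ hk, hσ _ _ (Nat.succ_le_succ hk)]
  push_cast
  rw [show (n : ℝ) + 1 - (k + 1) = n - k by ring,
    show (n : ℝ) + 1 + α + 1 = (n + α + 1) + 1 by ring,
    Real.Gamma_add_one (s := (n : ℝ) + 1) (by positivity),
    Real.Gamma_add_one (s := (n : ℝ) + α + 1) (by positivity)]
  have g1 := Real.Gamma_pos_of_pos (s := (n : ℝ) - k + α) (by linarith)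
  have g2 := Real.Gamma_pos_of_pos (s := (n : ℝ) + 1) (by linarith)
  have g3 := Real.Gamma_pos_of_pos (s := (n : ℝ) - k + 1) (by linarith)
  have g4 := Real.Gamma_pos_of_pos (s := (n : ℝ) + α + 1) (by linarith)
  rw [div_le_div_iff₀ (by positivity) (by positivity)]
  have : 0 ≤ α * Real.Gamma (n - k + α) * Real.Gamma (n + 1) * Real.Gamma (n - k + 1) *
    Real.Gamma (n + α + 1) * α := by positivity
  linarith

/-- The number of `m`-step simple walks on `ℤ` between `0` and `i`. -/
def walkCount : ℕ → ℤ → ℝ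
  | 0, i => if i = 0 then 1 else 0
  | m + 1, i => walkCount m (i + 1) + walkCount m (i - 1)

theorem walkCount_two_mul_sub (m : ℕ) (s : ℤ) :
    walkCount m (2 * s - m) = (if 0 ≤ s then (m.choose s.toNat : ℝ) else 0) ∧
      walkCount m (2 * s - m + 1) = 0 := by
  induction m generalizing s with
  | zero =>
    refine ⟨?_, ?_⟩
    · rcases lt_trichotomy s 0 with h | rfl | h
      · simp [walkCount, h.ne, not_le.mpr h]
      · simp [walkCount]
      · obtain ⟨k, rfl⟩ : ∃ k : ℕ, s = k + 1 := ⟨(s - 1).toNat, by omega⟩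
        have : ((k : ℤ) + 1).toNat = k + 1 := by omega
        simp [walkCount, h.ne', h.le, this]
    · have : 2 * s + 1 ≠ 0 := by omega
      simp [walkCount, this]
  | succ m ih =>
    constructor
    · rw [walkCount, show 2 * s - ((m + 1 : ℕ) : ℤ) + 1 = 2 * s - m by push_cast; ring,
        show 2 * s - ((m + 1 : ℕ) : ℤ) - 1 = 2 * (s - 1) - m by push_cast; ring, (ih _).1, (ih _).1]
      rcases lt_trichotomy s 0 with h | rfl | h
      · simp [not_le.mpr h, show ¬ (1 ≤ s) by omega]
      · simp
      · obtain ⟨k, rfl⟩ : ∃ k : ℕ, s = k + 1 := ⟨(s - 1).toNat, by omega⟩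
        have : ((k : ℤ) + 1).toNat = k + 1 := by omega
        simp [h.le, this, Nat.choose_succ_succ, add_comm]
    · rw [walkCount, show 2 * s - ((m + 1 : ℕ) : ℤ) + 1 + 1 = 2 * s - m + 1 by push_cast; ring,
        show 2 * s - ((m + 1 : ℕ) : ℤ) + 1 - 1 = 2 * (s - 1) - m + 1 by push_cast; ring,
        (ih _).2, (ih _).2, add_zero]

theorem walkCount_even (j : ℕ) : walkCount (2 * j) 0 = j.centralBinom := by
  have := (walkCount_two_mul_sub (2 * j) j).1
  simpa [Nat.centralBinom] using this

theorem walkCount_odd (j : ℕ) : walkCount (2 * j + 1) 0 = 0 := by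
  have := (walkCount_two_mul_sub (2 * j + 1) j).2
  simpa using this

/-- Mixed moments of a nearly periodic three-term recurrence are asymptotically, in the mean,
those of the recurrence with constant coefficients `0` and `b`. -/
theorem MeanNull.moments {σ : ℕ → ℕ → ℝ} (hσ : ∀ n k, k ≤ n → 0 ≤ σ n k)
    {a b : ℕ → ℕ → ℝ} {A B : ℝ} (hA : ∀ N k, |a N k| ≤ A) (hB : ∀ N k, |b N k| ≤ B)
    (ha : MeanNull σ a)
    (has : ∀ i : ℤ, MeanNull σ (fun N k => a N ((k : ℤ) + i).toNat - a N k))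
    (hbs : ∀ i : ℤ, MeanNull σ (fun N k => b N ((k : ℤ) + i).toNat - b N k))
    {M : ℕ → ℤ → ℕ → ℕ → ℝ} (hM0 : ∀ i N k, M 0 i N k = if i = 0 then 1 else 0)
    (hM : ∀ m i N k, M (m + 1) i N k = b N ((k : ℤ) + (i + 1)).toNat * M m (i + 1) N k +
      a N ((k : ℤ) + i).toNat * M m i N k + b N ((k : ℤ) + i).toNat * M m (i - 1) N k) (m : ℕ) :
    ∀ i, MeanNull σ (fun N k => M m i N k - b N k ^ m * walkCount m i) := by
  have hbd : ∀ m, ∃ C : ℝ, ∀ i N k, |M m i N k| ≤ C := by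
    intro m
    induction m with
    | zero => exact ⟨1, fun i N k => by rw [hM0]; split_ifs <;> simp⟩
    | succ m ih =>
      obtain ⟨C, hC⟩ := ih
      have hC0 : 0 ≤ C := (abs_nonneg _).trans (hC 0 0 0)
      refine ⟨B * C + A * C + B * C, fun i N k => ?_⟩
      rw [hM]
      refine (abs_add_le _ _).trans (add_le_add ((abs_add_le _ _).trans (add_le_add ?_ ?_)) ?_) <;>
        rw [abs_mul]
      · exact mul_le_mul (hB _ _) (hC _ _ _) (abs_nonneg _) ((abs_nonneg _).trans (hB 0 0))
      · exact mul_le_mul (hA _ _) (hC _ _ _) (abs_nonneg _) ((abs_nonneg _).trans (hA 0 0))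
      · exact mul_le_mul (hB _ _) (hC _ _ _) (abs_nonneg _) ((abs_nonneg _).trans (hB 0 0))
  induction m with
  | zero =>
    intro i
    simpa [hM0, walkCount] using MeanNull.zero
  | succ m ih =>
    intro i
    obtain ⟨C, hC⟩ := hbd m
    have h1 := MeanNull.mul_sub_mul hσ (hbs (i + 1)) (ih (i + 1)) (fun N k => hC _ N k) hB
    have h2 := MeanNull.mul_sub_mul hσ (hbs i) (ih (i - 1)) (fun N k => hC _ N k) hB
    have h3 := MeanNull.mul_bounded hσ (MeanNull.add hσ (has i) ha) (fun N k => hC i N k)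
    have h := MeanNull.add hσ (MeanNull.add hσ h1 h2) h3
    have e : (fun N k => M (m + 1) i N k - b N k ^ (m + 1) * walkCount (m + 1) i) = fun N (k : ℕ) =>
        b N ((k : ℤ) + (i + 1)).toNat * M m (i + 1) N k -
          b N k * (b N k ^ m * walkCount m (i + 1)) +
        (b N ((k : ℤ) + i).toNat * M m (i - 1) N k - b N k * (b N k ^ m * walkCount m (i - 1))) +
        (a N ((k : ℤ) + i).toNat - a N k + a N k) * M m i N k := by
      funext N k
      rw [hM, walkCount]
      ring
    rwa [e]

theorem intervalIntegrable_one_sub_sq_rpow {c : ℝ} (hc : -1 < c) :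
    IntervalIntegrable (fun x : ℝ => (1 - x ^ 2) ^ c) volume (-1) 1 := by
  have h1 : IntervalIntegrable (fun x : ℝ => (1 - x) ^ c * (1 + x) ^ c) volume 0 1 := by
    refine IntervalIntegrable.mul_continuousOn ?_ ?_
    · have := (intervalIntegral.intervalIntegrable_rpow' (a := 1) (b := 0) hc).comp_sub_left 1
      simpa using this
    · rw [Set.uIcc_of_le zero_le_one]
      refine ContinuousOn.rpow_const (by fun_prop) fun x hx => Or.inl ?_
      have := hx.1
      positivity
  have h2 : IntervalIntegrable (fun x : ℝ => (1 - x ^ 2) ^ c) volume 0 1 := by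
    refine h1.congr fun x hx => ?_
    rw [Set.uIoc_of_le zero_le_one] at hx
    have : 0 ≤ 1 - x := by linarith [hx.2]
    have : 0 ≤ 1 + x := by linarith [hx.1]
    rw [← Real.mul_rpow ‹_› ‹_›]
    congr 1; ring
  have h3 : IntervalIntegrable (fun x : ℝ => (1 - x ^ 2) ^ c) volume (-1) 0 := by
    have := (h2.comp_sub_left 0).symm
    simpa using this
  exact h3.trans h2

theorem intervalIntegrable_mul_one_sub_sq_rpow {c : ℝ} (hc : -1 < c) {f : ℝ → ℝ}
    (hf : Continuous f) :
    IntervalIntegrable (fun x : ℝ => f x * (1 - x ^ 2) ^ c) volume (-1) 1 :=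
  (intervalIntegrable_one_sub_sq_rpow hc).continuousOn_mul hf.continuousOn

theorem integral_one_sub_sq_rpow_pos {c : ℝ} (hc : -1 < c) :
    0 < ∫ x in (-1 : ℝ)..1, (1 - x ^ 2) ^ c := by
  refine intervalIntegral.intervalIntegral_pos_of_pos_on (intervalIntegrable_one_sub_sq_rpow hc)
    (fun x hx => ?_) (by norm_num)
  exact Real.rpow_pos_of_pos (by nlinarith [hx.1, hx.2]) _

theorem integral_odd_pow_mul_one_sub_sq_rpow (c : ℝ) (j : ℕ) :
    ∫ x in (-1 : ℝ)..1, x ^ (2 * j + 1) * (1 - x ^ 2) ^ c = 0 := by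
  have h := intervalIntegral.integral_comp_neg (a := -1) (b := 1)
    (fun x : ℝ => x ^ (2 * j + 1) * (1 - x ^ 2) ^ c)
  have e : ∀ x : ℝ, (-x) ^ (2 * j + 1) * (1 - (-x) ^ 2) ^ c =
      -(x ^ (2 * j + 1) * (1 - x ^ 2) ^ c) := fun x => by
    rw [Odd.neg_pow ⟨j, rfl⟩, neg_sq, neg_mul]
  simp only [e, intervalIntegral.integral_neg, neg_neg] at h
  linarith

theorem integral_pow_add_two_mul_one_sub_sq_rpow {c : ℝ} (hc : -1 < c) (m : ℕ) :
    (m + 2 * c + 3) * ∫ x in (-1 : ℝ)..1, x ^ (m + 2) * (1 - x ^ 2) ^ c =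
      (m + 1) * ∫ x in (-1 : ℝ)..1, x ^ m * (1 - x ^ 2) ^ c := by
  have hi : ∀ m : ℕ, IntervalIntegrable (fun x : ℝ => x ^ m * (1 - x ^ 2) ^ c) volume (-1) 1 :=
    fun m => intervalIntegrable_mul_one_sub_sq_rpow hc (by fun_prop)
  have key := intervalIntegral.integral_eq_sub_of_hasDerivAt_of_le (a := -1) (b := 1)
    (f := fun x : ℝ => x ^ (m + 1) * (1 - x ^ 2) ^ (c + 1))
    (f' := fun x : ℝ => (m + 1) * (x ^ m * (1 - x ^ 2) ^ c) -
      (m + 2 * c + 3) * (x ^ (m + 2) * (1 - x ^ 2) ^ c)) (by norm_num)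
    (by
      refine ContinuousOn.mul (by fun_prop) ?_
      exact ContinuousOn.rpow_const (by fun_prop) fun x hx => Or.inr (by linarith))
    (fun x hx => by
      have hpos : 0 < 1 - x ^ 2 := by nlinarith [hx.1, hx.2]
      have h1 : HasDerivAt (fun x : ℝ => 1 - x ^ 2) (-(2 * x)) x := by
        simpa using (hasDerivAt_pow 2 x).const_sub 1
      have h2 := (hasDerivAt_pow (m + 1) x).mul (h1.rpow_const (p := c + 1) (Or.inl hpos.ne'))
      refine h2.congr_deriv ?_
      rw [Real.rpow_add_one hpos.ne', add_sub_cancel_right]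
      push_cast
      ring)
    (((hi m).const_mul _).sub ((hi (m + 2)).const_mul _))
  rw [intervalIntegral.integral_sub ((hi m).const_mul _) ((hi (m + 2)).const_mul _),
    intervalIntegral.integral_const_mul, intervalIntegral.integral_const_mul] at key
  simp [Real.zero_rpow (show c + 1 ≠ 0 by linarith)] at key
  linarith

theorem integral_even_pow_mul_one_sub_sq_rpow {α : ℝ} (hα : 0 < α) (j : ℕ) :
    ∫ x in (-1 : ℝ)..1, x ^ (2 * j) * (1 - x ^ 2) ^ ((α - 1) / 2) =
      j.centralBinom * (Real.Gamma (α / 2 + 1) * Real.Gamma (j + 1) /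
        (4 ^ j * Real.Gamma (α / 2 + j + 1))) *
        ∫ x in (-1 : ℝ)..1, (1 - x ^ 2) ^ ((α - 1) / 2) := by
  induction j with
  | zero =>
    have := (Real.Gamma_pos_of_pos (s := α / 2 + 1) (by linarith)).ne'
    simp [this]
  | succ j ih =>
    have hrec := integral_pow_add_two_mul_one_sub_sq_rpow (c := (α - 1) / 2) (by linarith) (2 * j)
    rw [ih] at hrec
    have hcb : ((j : ℝ) + 1) * (j + 1).centralBinom = 2 * (2 * j + 1) * j.centralBinom := by
      exact_mod_cast Nat.succ_mul_centralBinom_succ j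
    have hj : (0 : ℝ) ≤ j := j.cast_nonneg
    have hG := (Real.Gamma_pos_of_pos (s := α / 2 + j + 1) (by positivity)).ne'
    rw [show 2 * (j + 1) = 2 * j + 2 by ring]
    push_cast at hrec ⊢
    rw [show α / 2 + (j + 1) + 1 = (α / 2 + j + 1) + 1 by ring,
      Real.Gamma_add_one (s := α / 2 + j + 1) (by positivity),
      Real.Gamma_add_one (s := (j : ℝ) + 1) (by positivity)]
    have hne : 2 * (j : ℝ) + 2 * ((α - 1) / 2) + 3 ≠ 0 := by
      have : 2 * (j : ℝ) + 2 * ((α - 1) / 2) + 3 = 2 * j + α + 2 := by ring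
      rw [this]; positivity
    refine mul_left_cancel₀ hne (hrec.trans ?_)
    have h4 : α / 2 + j + 1 ≠ 0 := by positivity
    rw [pow_succ]
    generalize (∫ x in (-1 : ℝ)..1, (1 - x ^ 2) ^ ((α - 1) / 2)) = I
    field_simp
    linear_combination (-2 * (α + 2 * j + 2) * I) * hcb

/-- The limiting moments are those of the normalized ultraspherical measure. -/
theorem walkCount_mul_gamma_eq_moment {α : ℝ} (hα : 0 < α) (m : ℕ) :
    Real.Gamma (α / 2 + 1) * Real.Gamma ((m : ℝ) / 2 + 1) /
        (2 ^ m * Real.Gamma ((α + (m : ℝ)) / 2 + 1)) * walkCount m 0 =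
      (1 / (∫ x in (-1 : ℝ)..1, (1 - x ^ 2) ^ ((α - 1) / 2))) *
        ∫ x in (-1 : ℝ)..1, x ^ m * (1 - x ^ 2) ^ ((α - 1) / 2) := by
  have hI := (integral_one_sub_sq_rpow_pos (c := (α - 1) / 2) (by linarith)).ne'
  obtain ⟨j, rfl | rfl⟩ := m.even_or_odd'
  · rw [walkCount_even, integral_even_pow_mul_one_sub_sq_rpow hα, pow_mul]
    push_cast
    rw [show (2 * (j : ℝ)) / 2 = j by ring, show (α + 2 * (j : ℝ)) / 2 = α / 2 + j by ring]
    norm_num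
    field_simp
  · rw [walkCount_odd, integral_odd_pow_mul_one_sub_sq_rpow]
    simp

/-- The `j`-th member of a sequence of polynomials, extended by zero to negative indices. -/
noncomputable def intExtend (p : ℕ → Polynomial ℝ) (j : ℤ) : Polynomial ℝ :=
  if 0 ≤ j then p j.toNat else 0

theorem X_mul_intExtend {p : ℕ → Polynomial ℝ} {a b : ℕ → ℝ} (hb0 : b 0 = 0)
    (hrec : ∀ l, Polynomial.X * p l = Polynomial.C (b (l + 1)) * p (l + 1) +
      Polynomial.C (a l) * p l + Polynomial.C (b l) * p (l - 1)) (j : ℤ) :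
    Polynomial.X * intExtend p j = Polynomial.C (b (j + 1).toNat) * intExtend p (j + 1) +
      Polynomial.C (a j.toNat) * intExtend p j + Polynomial.C (b j.toNat) * intExtend p (j - 1) := by
  rcases lt_trichotomy j 0 with h | rfl | h
  · rcases eq_or_ne j (-1) with rfl | h'
    · simp [intExtend, hb0]
    · simp [intExtend, not_le.mpr h, show ¬ (0 ≤ j + 1) by omega, show ¬ (1 ≤ j) by omega]
  · simpa [intExtend, hb0] using hrec 0
  · obtain ⟨k, rfl⟩ : ∃ k : ℕ, j = k + 1 := ⟨(j - 1).toNat, by omega⟩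
    have e1 : ((k : ℤ) + 1).toNat = k + 1 := by omega
    have e2 : ((k : ℤ) + 1 + 1).toNat = k + 2 := by omega
    have h1 : (0 : ℤ) ≤ k + 1 + 1 := by omega
    simpa [intExtend, h.le, h1, e1, e2] using hrec (k + 1)

theorem integrable_of_continuous_of_compl_Icc {ν : Measure ℝ} [IsFiniteMeasure ν] {R : ℝ}
    (hR : ν (Set.Icc (-R) R)ᶜ = 0) {f : ℝ → ℝ} (hf : Continuous f) : Integrable f ν := by
  have h : Integrable f (ν.restrict (Set.Icc (-R) R)) := hf.continuousOn.integrableOn_Icc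
  rwa [Measure.restrict_eq_self_of_ae_mem] at h
  exact hR

theorem integral_mul_sub_le {ν : Measure ℝ} [IsFiniteMeasure ν] {R : ℝ}
    (hR : ν (Set.Icc (-R) R)ᶜ = 0) {f g p : ℝ → ℝ} (hf : Continuous f) (hg : Continuous g)
    (hp : Continuous p) (hp1 : ∫ x, p x ^ 2 ∂ν = 1) {ε : ℝ}
    (h : ∀ x ∈ Set.Icc (-R) R, |g x - f x| ≤ ε) :
    |(∫ x, f x * p x ^ 2 ∂ν) - ∫ x, g x * p x ^ 2 ∂ν| ≤ ε := by
  have hi : ∀ {u : ℝ → ℝ}, Continuous u → Integrable u ν :=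
    fun hu => integrable_of_continuous_of_compl_Icc hR hu
  rw [← integral_sub (hi (by fun_prop)) (hi (by fun_prop))]
  refine (abs_integral_le_integral_abs).trans ?_
  calc ∫ x, |f x * p x ^ 2 - g x * p x ^ 2| ∂ν ≤ ∫ x, ε * p x ^ 2 ∂ν := by
        refine integral_mono_ae (hi (by fun_prop)) (hi (by fun_prop)) ?_
        have hae : ∀ᵐ x ∂ν, x ∈ Set.Icc (-R) R := hR
        filter_upwards [hae] with x hx
        rw [← sub_mul, abs_mul, abs_of_nonneg (sq_nonneg (p x)), abs_sub_comm]
        exact mul_le_mul_of_nonneg_right (h x hx) (sq_nonneg _)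
    _ = ε := by rw [integral_const_mul, hp1, mul_one]

theorem ultraspherical_mean_sub_le {c : ℝ} (hc : -1 < c) {f g : ℝ → ℝ} (hf : Continuous f)
    (hg : Continuous g) {ε : ℝ} (h : ∀ x ∈ Set.Icc (-1 : ℝ) 1, |g x - f x| ≤ ε) :
    |(1 / (∫ x in (-1 : ℝ)..1, (1 - x ^ 2) ^ c)) * (∫ x in (-1 : ℝ)..1, f x * (1 - x ^ 2) ^ c) -
      (1 / (∫ x in (-1 : ℝ)..1, (1 - x ^ 2) ^ c)) * ∫ x in (-1 : ℝ)..1, g x * (1 - x ^ 2) ^ c|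
      ≤ ε := by
  have hI := integral_one_sub_sq_rpow_pos hc
  have hfi := intervalIntegrable_mul_one_sub_sq_rpow hc hf
  have hgi := intervalIntegrable_mul_one_sub_sq_rpow hc hg
  rw [← mul_sub, ← intervalIntegral.integral_sub hfi hgi, abs_mul, abs_of_pos (by positivity),
    one_div, inv_mul_le_iff₀ hI]
  refine (intervalIntegral.abs_integral_le_integral_abs (by norm_num)).trans ?_
  rw [mul_comm, ← intervalIntegral.integral_const_mul]
  refine intervalIntegral.integral_mono_on (by norm_num) (hfi.sub hgi).abs
    ((intervalIntegrable_one_sub_sq_rpow hc).const_mul ε) fun x hx => ?_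
  have hw : 0 ≤ (1 - x ^ 2) ^ c := Real.rpow_nonneg (by nlinarith [hx.1, hx.2]) _
  rw [← sub_mul, abs_mul, abs_of_nonneg hw, abs_sub_comm]
  exact mul_le_mul_of_nonneg_right (h x hx) hw

theorem stmt16 (α : ℝ) (hα : 0 < α)
    (μ : ℕ → MeasureTheory.Measure ℝ)
    (hfin : ∀ k, MeasureTheory.IsFiniteMeasure (μ k))
    (hsupp : ∃ R : ℝ, ∀ k, μ k ((Set.Icc (-R) R)ᶜ) = 0)
    (p : ℕ → ℕ → Polynomial ℝ) (ca cb : ℕ → ℕ → ℝ)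
    (hdeg : ∀ k l, (p k l).natDegree = l)
    (hlead : ∀ k l, 0 < (p k l).leadingCoeff)
    (horth : ∀ k l m, (∫ x, (p k l).eval x * (p k m).eval x ∂ (μ k)) = if l = m then 1 else 0)
    (hb0 : ∀ k, cb k 0 = 0)
    (hbpos : ∀ k l, 0 < cb k (l+1))
    (hrec : ∀ k l, Polynomial.X * p k l =
      Polynomial.C (cb k (l+1)) * p k (l+1) + Polynomial.C (ca k l) * p k l +
      Polynomial.C (cb k l) * p k (l-1))
    (σ : ℕ → ℕ → ℝ)
    (hσ0 : ∀ n k, k ≤ n → 0 ≤ σ n k)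
    (hσ1 : ∀ n, ∑ k ∈ Finset.range (n+1), σ n k = 1)
    (hσ2 : ∀ k, Filter.Tendsto (fun n => σ n k) Filter.atTop (nhds 0))
    (hσdef : ∀ n k : ℕ, k ≤ n → σ n k =
      α * Real.Gamma ((n:ℝ)-(k:ℝ)+α) * Real.Gamma ((n:ℝ)+1) /
        (Real.Gamma ((n:ℝ)-(k:ℝ)+1) * Real.Gamma ((n:ℝ)+α+1)))
    (hbdA : ∃ A : ℝ, ∀ k n, |ca k n| ≤ A)
    (hbdB : ∃ B : ℝ, ∀ k n, cb k n ≤ B)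
    (hNa : ∀ l : ℕ, 1 ≤ l → Filter.Tendsto
      (fun n => ∑ k ∈ Finset.range (n+1), σ n k * |ca (n-k) (k+l) - ca (n-k) k|)
      Filter.atTop (nhds 0))
    (hNb : ∀ l : ℕ, 1 ≤ l → Filter.Tendsto
      (fun n => ∑ k ∈ Finset.range (n+1), σ n k * |cb (n-k) (k+l) - cb (n-k) k|)
      Filter.atTop (nhds 0))
    (hNs : ∀ la lb : ℕ, Filter.Tendsto
      (fun n => ∑ k ∈ Finset.range (n+1), σ n k * (ca (n-k) k)^la * (cb (n-k) k)^lb)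
      Filter.atTop (nhds (if 1 ≤ la then 0 else Real.Gamma (α/2+1) * Real.Gamma ((lb:ℝ)/2+1) / (2^lb * Real.Gamma ((α+(lb:ℝ))/2+1)))))
    :
    ∀ f : ℝ → ℝ, Continuous f → (∃ C : ℝ, ∀ x, |f x| ≤ C) →
      Filter.Tendsto (fun n => ∑ k ∈ Finset.range (n+1),
          σ n k * ∫ x, f x * ((p (n-k) k).eval x)^2 ∂ (μ (n-k)))
          Filter.atTop
        (nhds ((1 / (∫ x in (-1:ℝ)..1, (1 - x^2) ^ ((α-1)/2))) *
          ∫ x in (-1:ℝ)..1, f x * (1 - x^2) ^ ((α-1)/2))) := by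
  have hσ := hσ0
  have hstep := cesaro_weight_step hα hσdef
  obtain ⟨R, hR⟩ := hsupp
  obtain ⟨A, hA⟩ := hbdA
  obtain ⟨B, hB⟩ := hbdB
  have hB' : ∀ N k, |cb N k| ≤ B := fun N k => by
    rw [abs_of_nonneg]
    · exact hB N k
    · cases k with
      | zero => exact (hb0 N).ge
      | succ k => exact (hbpos N k).le
  have hint : ∀ N {u : ℝ → ℝ}, Continuous u → Integrable u (μ N) := fun N u hu =>
    have := hfin N
    integrable_of_continuous_of_compl_Icc (hR N) hu
  have hone : ∀ N k, ∫ x, (p N k).eval x ^ 2 ∂(μ N) = 1 := fun N k => by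
    simpa [sq] using horth N k k
  have ha : MeanNull σ ca := by
    refine MeanNull.of_sq hσ hσ1 ?_
    simpa using hNs 2 0
  have hmom := MeanNull.moments (σ := σ) hσ hA hB' ha
    (MeanNull.shift_int hσ (hσ2 0) hstep hA hNa) (MeanNull.shift_int hσ (hσ2 0) hstep hB' hNb)
    (M := fun m i N k => ∫ x, x ^ m * (p N k).eval x *
      (intExtend (p N) ((k : ℤ) + i)).eval x ∂(μ N))
    (by
      intro i N k
      simp only [pow_zero, one_mul, intExtend]
      rcases lt_or_ge ((k : ℤ) + i) 0 with h | h
      · simp [not_le.mpr h, show i ≠ 0 by omega]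
      · simp only [h, if_true]
        rw [horth]
        exact if_congr (by omega) rfl rfl)
    (by
      intro m i N k
      rw [← integral_const_mul, ← integral_const_mul, ← integral_const_mul,
        ← integral_add (hint N (by fun_prop)) (hint N (by fun_prop)),
        ← integral_add (hint N (by fun_prop)) (hint N (by fun_prop))]
      congr 1
      funext x
      have h := congrArg (Polynomial.eval x) (X_mul_intExtend (hb0 N) (hrec N) ((k : ℤ) + i))
      simp only [Polynomial.eval_add, Polynomial.eval_mul, Polynomial.eval_X,
        Polynomial.eval_C] at h
      rw [← add_assoc, ← add_sub_assoc]
      linear_combination (x ^ m * (p N k).eval x) * h)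
  have hmono : ∀ m : ℕ, Tendsto (fun n => ∑ k ∈ Finset.range (n+1),
      σ n k * ∫ x, x ^ m * ((p (n-k) k).eval x)^2 ∂ (μ (n-k))) atTop
      (nhds ((1 / (∫ x in (-1:ℝ)..1, (1 - x^2) ^ ((α-1)/2))) *
        ∫ x in (-1:ℝ)..1, x ^ m * (1 - x^2) ^ ((α-1)/2))) := by
    intro m
    rw [← walkCount_mul_gamma_eq_moment hα]
    have hb : Tendsto (fun n => ∑ k ∈ Finset.range (n + 1),
        σ n k * (cb (n - k) k ^ m * walkCount m 0)) atTop
        (nhds (Real.Gamma (α / 2 + 1) * Real.Gamma ((m : ℝ) / 2 + 1) /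
          (2 ^ m * Real.Gamma ((α + (m : ℝ)) / 2 + 1)) * walkCount m 0)) := by
      have := (hNs 0 m).mul_const (walkCount m 0)
      simpa [Finset.sum_mul, mul_assoc] using this
    have := MeanNull.tendsto hσ (hmom m 0) (v := fun N k => cb N k ^ m * walkCount m 0) hb
    simpa [intExtend, sq, mul_assoc] using this
  have hc : -1 < (α - 1) / 2 := by linarith
  have hpoly : ∀ q : Polynomial ℝ, Tendsto (fun n => ∑ k ∈ Finset.range (n+1),
      σ n k * ∫ x, q.eval x * ((p (n-k) k).eval x)^2 ∂ (μ (n-k))) atTop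
      (nhds ((1 / (∫ x in (-1:ℝ)..1, (1 - x^2) ^ ((α-1)/2))) *
        ∫ x in (-1:ℝ)..1, q.eval x * (1 - x^2) ^ ((α-1)/2))) := by
    intro q
    induction q using Polynomial.induction_on' with
    | add q r hq hr =>
      simp only [Polynomial.eval_add, add_mul]
      rw [intervalIntegral.integral_add
        (intervalIntegrable_mul_one_sub_sq_rpow hc q.continuous)
        (intervalIntegrable_mul_one_sub_sq_rpow hc r.continuous), mul_add]
      refine (hq.add hr).congr fun n => ?_
      rw [← Finset.sum_add_distrib]
      refine Finset.sum_congr rfl fun k _ => ?_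
      rw [integral_add (hint _ (by fun_prop)) (hint _ (by fun_prop)), mul_add]
    | monomial m r =>
      simp only [Polynomial.eval_monomial, mul_assoc, integral_const_mul,
        intervalIntegral.integral_const_mul]
      convert (hmono m).const_mul r using 1
      · funext n
        rw [Finset.mul_sum]
        exact Finset.sum_congr rfl fun k _ => by ring
      · congr 1
        ring
  intro f hf _
  rw [Metric.tendsto_atTop]
  intro ε hε
  obtain ⟨q, hq⟩ := exists_polynomial_near_of_continuousOn (-max R 1) (max R 1) f
    hf.continuousOn (ε / 3) (by positivity)
  obtain ⟨n₀, hn₀⟩ := Metric.tendsto_atTop.mp (hpoly q) (ε / 3) (by positivity)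
  refine ⟨n₀, fun n hn => ?_⟩
  have h1 := hn₀ n hn
  have h2 := ultraspherical_mean_sub_le hc hf q.continuous (ε := ε / 3) fun x hx =>
    (hq x ⟨by linarith [hx.1, le_max_right R 1], hx.2.trans (le_max_right R 1)⟩).le
  have h3 : |(∑ k ∈ Finset.range (n+1),
      σ n k * ∫ x, f x * ((p (n-k) k).eval x)^2 ∂ (μ (n-k))) - ∑ k ∈ Finset.range (n+1),
      σ n k * ∫ x, q.eval x * ((p (n-k) k).eval x)^2 ∂ (μ (n-k))| ≤ ε / 3 := by
    rw [← Finset.sum_sub_distrib]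
    calc _ ≤ ∑ k ∈ Finset.range (n+1), σ n k * (ε / 3) := by
          refine (Finset.abs_sum_le_sum_abs _ _).trans (Finset.sum_le_sum fun k hk => ?_)
          have h0 := hσ n k (Nat.lt_succ_iff.mp (Finset.mem_range.mp hk))
          rw [← mul_sub, abs_mul, abs_of_nonneg h0]
          refine mul_le_mul_of_nonneg_left ?_ h0
          have := hfin (n - k)
          exact integral_mul_sub_le (hR (n - k)) hf q.continuous (p (n - k) k).continuous
            (hone _ _) fun x hx => (hq x ⟨by linarith [hx.1, le_max_left R 1],
              hx.2.trans (le_max_left R 1)⟩).le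
      _ = ε / 3 := by rw [← Finset.sum_mul, hσ1, one_mul]
  rw [Real.dist_eq] at h1 ⊢
  rw [abs_lt] at h1 ⊢
  rw [abs_le] at h2 h3
  constructor <;> linarith [h1.1, h1.2, h2.1, h2.2, h3.1, h3.2]
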